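/- arXiv:1002.3247 — 2 statements merged into one kernel-verified Lean document; each statement's English description precedes it below -/
import Mathlib

section
/- Let C be a Hom-finite extension-closed subcategory of an abelian k-category and M = M₁ ⊕ … ⊕ Mₙ an object of C with Ext¹_C(M, M) = 0, the Mᵢ indecomposable and pairwise nonisomorphic. Suppose for each i the minimal left add(⊕_{j<i} Mⱼ)-approximation fᵢ: Mᵢ → Mᵢ' is surjective. Then for each i, the Γ-module Δᵢ := Hom_C(Ker fᵢ, M) over Γ = End_C(M) has projective dimension at most 1. -/
open CategoryTheory CategoryTheory.Limits

attribute [local instance] CategoryTheory.Limits.HasFiniteBiproducts.of_hasFiniteProducts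
attribute [local instance] CategoryTheory.Limits.hasBinaryBiproducts_of_finite_biproducts

/-!
STATEMENT 3. Let C be a Hom-finite extension-closed subcategory of an abelian k-category
and M = M₁ ⊕ … ⊕ Mₙ an object of C with Ext¹_C(M, M) = 0, the Mᵢ indecomposable and
pairwise nonisomorphic.  Suppose for each i the minimal left add(⊕_{j<i} Mⱼ)-approximation
fᵢ : Mᵢ → Mᵢ' is surjective.  Then for each i the Γ = End_C(M)-module
Δᵢ = Hom_C(Ker fᵢ, M) has projective dimension at most 1.
-/

universe v u

/-- The action of `Γ = End M` on `Hom(X, M)` by post-composition. -/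
noncomputable instance homEndModule {𝒜 : Type u} [Category.{v} 𝒜] [Abelian 𝒜] (X M : 𝒜) :
    Module (End M) (X ⟶ M) where
  smul γ φ := φ ≫ γ
  one_smul φ := Category.comp_id φ
  mul_smul γ δ φ := (Category.assoc φ δ γ).symm
  smul_zero _ := Limits.zero_comp
  smul_add _ _ _ := Preadditive.add_comp _ _ _ _ _ _
  add_smul _ _ _ := Preadditive.comp_add _ _ _ _ _ _
  zero_smul _ := Limits.comp_zero

/-- projective dimension at most `n`. -/
def pdLE (R : Type v) [Ring R] : ℕ → ModuleCat.{v} R → Prop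
  | 0, D => Module.Projective R D
  | n + 1, D => ∃ (P : ModuleCat.{v} R) (p : P →ₗ[R] D), Module.Projective R P ∧
      Function.Surjective p ∧ pdLE R n (ModuleCat.of R (LinearMap.ker p))

/-- `X ∈ add (⊕_{j < i} Mⱼ)` : a direct summand of a finite direct sum of copies
of the `Mⱼ` with `j < i`. -/
def BelowAdd {𝒜 : Type u} [Category.{v} 𝒜] [Abelian 𝒜] {n : ℕ} (Mi : Fin n → 𝒜)
    (i : Fin n) (X : 𝒜) : Prop :=
  ∃ (m : ℕ) (s : X ⟶ ⨁ fun q : Fin m × {j : Fin n // j < i} => Mi q.2.1)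
    (r : (⨁ fun q : Fin m × {j : Fin n // j < i} => Mi q.2.1) ⟶ X), s ≫ r = 𝟙 X

section

variable {𝒜 : Type u} [Category.{v} 𝒜] [Abelian 𝒜]

/-- Precomposition with `a : X ⟶ Y`, as an `End M`-linear map `Hom(Y, M) → Hom(X, M)`. -/
def precompLinear {X Y : 𝒜} (a : X ⟶ Y) (M : 𝒜) : (Y ⟶ M) →ₗ[End M] (X ⟶ M) where
  toFun φ := a ≫ φ
  map_add' _ _ := Preadditive.comp_add _ _ _ _ _ _
  map_smul' γ φ := (Category.assoc a φ γ).symm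

theorem projective_hom_of_retract {X Y M : 𝒜} (s : X ⟶ Y) (r : Y ⟶ X) (h : s ≫ r = 𝟙 X)
    [Module.Projective (End M) (Y ⟶ M)] : Module.Projective (End M) (X ⟶ M) := by
  refine Module.Projective.of_split (precompLinear r M) (precompLinear s M) ?_
  ext φ
  change s ≫ r ≫ φ = φ
  rw [reassoc_of% h]

instance projective_hom_self (M : 𝒜) : Module.Projective (End M) (M ⟶ M) :=
  let e : End M ≃ₗ[End M] (M ⟶ M) :=
    { toFun := fun φ => φ
      map_add' := fun _ _ => rfl
      map_smul' := fun _ _ => rfl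
      invFun := fun φ => φ
      left_inv := fun _ => rfl
      right_inv := fun _ => rfl }
  Module.Projective.of_equiv e

theorem projective_hom_biproduct {ι : Type*} [Finite ι] (X : ι → 𝒜) (M : 𝒜)
    [∀ q, Module.Projective (End M) (X q ⟶ M)] :
    Module.Projective (End M) ((⨁ X) ⟶ M) := by
  have := Fintype.ofFinite ι
  classical
  let e : (∀ q, X q ⟶ M) ≃ₗ[End M] ((⨁ X) ⟶ M) :=
    { toFun := fun φ => biproduct.desc φ
      map_add' := fun _ _ => by ext; simp
      map_smul' := fun γ φ => by
        ext q
        change _ = biproduct.ι X q ≫ biproduct.desc φ ≫ γ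
        simp only [biproduct.ι_desc, biproduct.ι_desc_assoc]
        rfl
      invFun := fun ψ q => biproduct.ι X q ≫ ψ
      left_inv := fun _ => by ext; simp
      right_inv := fun _ => by ext; simp }
  exact Module.Projective.of_equiv (DFinsupp.linearEquivFunOnFintype.trans e)

/-- Every map from `X` lifts along the quotient map of any extension by `M`; this expresses
`Ext¹(X, M) = 0`. -/
def LiftsAlongExtensionsBy (M X : 𝒜) : Prop :=
  ∀ S : ShortComplex 𝒜, S.ShortExact → S.X₁ = M → ∀ h : X ⟶ S.X₃, ∃ t : X ⟶ S.X₂, t ≫ S.g = h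

theorem LiftsAlongExtensionsBy.of_retract {M X Y : 𝒜} (hY : LiftsAlongExtensionsBy M Y)
    (s : X ⟶ Y) (r : Y ⟶ X) (hsr : s ≫ r = 𝟙 X) : LiftsAlongExtensionsBy M X := by
  intro S hS h₁ h
  obtain ⟨t, ht⟩ := hY S hS h₁ (r ≫ h)
  exact ⟨s ≫ t, by rw [Category.assoc, ht, reassoc_of% hsr]⟩

theorem LiftsAlongExtensionsBy.biproduct {M : 𝒜} {ι : Type*} [Finite ι] {X : ι → 𝒜}
    (hX : ∀ q, LiftsAlongExtensionsBy M (X q)) : LiftsAlongExtensionsBy M (⨁ X) := by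
  intro S hS h₁ h
  choose t ht using fun q => hX q S hS h₁ (biproduct.ι X q ≫ h)
  exact ⟨biproduct.desc t, by ext q; simp [ht]⟩

theorem shortExact_pullback {S : ShortComplex 𝒜} (hS : S.ShortExact) {Y : 𝒜} (h : Y ⟶ S.X₃) :
    (ShortComplex.mk (pullback.lift S.f 0 (by simp) : S.X₁ ⟶ pullback S.g h)
      (pullback.snd S.g h) (pullback.lift_snd _ _ _)).ShortExact := by
  have := hS.mono_f
  have := hS.epi_g
  have w : S.f ≫ S.g = (0 : S.X₁ ⟶ Y) ≫ h := by simp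
  have : Mono (pullback.lift S.f 0 w) := mono_of_mono_fac (pullback.lift_fst _ _ w)
  refine ShortComplex.ShortExact.mk' (ShortComplex.exact_of_f_is_kernel _ ?_) this inferInstance
  refine KernelFork.IsLimit.ofι' _ _ fun {A} (k : A ⟶ pullback S.g h) hk => ?_
  have hk₀ : k ≫ pullback.snd S.g h = 0 := hk
  have hk' : (k ≫ pullback.fst S.g h) ≫ S.g = 0 := by
    rw [Category.assoc, pullback.condition, reassoc_of% hk₀, zero_comp]
  refine ⟨hS.exact.lift _ hk', pullback.hom_ext ?_ ?_⟩
  · change (hS.exact.lift _ hk' ≫ pullback.lift S.f 0 w) ≫ pullback.fst S.g h = _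
    rw [Category.assoc, pullback.lift_fst, hS.exact.lift_f]
  · change (hS.exact.lift _ hk' ≫ pullback.lift S.f 0 w) ≫ pullback.snd S.g h = _
    rw [Category.assoc, pullback.lift_snd, comp_zero]
    exact hk₀.symm

theorem shortExact_pushout {S : ShortComplex 𝒜} (hS : S.ShortExact) {Y : 𝒜} (h : S.X₁ ⟶ Y) :
    (ShortComplex.mk (pushout.inr S.f h)
      (pushout.desc S.g 0 (by simp) : pushout S.f h ⟶ S.X₃)
      (pushout.inr_desc _ _ _)).ShortExact := by
  have := hS.mono_f
  have := hS.epi_g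
  have w : S.f ≫ S.g = h ≫ (0 : Y ⟶ S.X₃) := by simp
  have : Epi (pushout.desc S.g 0 w) := epi_of_epi_fac (pushout.inl_desc _ _ w)
  refine ShortComplex.ShortExact.mk' (ShortComplex.exact_of_g_is_cokernel _ ?_) inferInstance this
  refine CokernelCofork.IsColimit.ofπ' _ _ fun {A} (k : pushout S.f h ⟶ A) hk => ?_
  have hk₀ : pushout.inr S.f h ≫ k = 0 := hk
  have hk' : S.f ≫ pushout.inl S.f h ≫ k = 0 := by
    rw [pushout.condition_assoc, hk₀, comp_zero]
  refine ⟨hS.exact.desc _ hk', pushout.hom_ext ?_ ?_⟩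
  · change pushout.inl S.f h ≫ pushout.desc S.g 0 w ≫ hS.exact.desc _ hk' = _
    rw [pushout.inl_desc_assoc, hS.exact.g_desc]
  · change pushout.inr S.f h ≫ pushout.desc S.g 0 w ≫ hS.exact.desc _ hk' = _
    rw [pushout.inr_desc_assoc, zero_comp]
    exact hk₀.symm

theorem LiftsAlongExtensionsBy.self {M : 𝒜}
    (hM : ∀ (E : 𝒜) (f : M ⟶ E) (g : E ⟶ M) (w : f ≫ g = 0),
      (ShortComplex.mk f g w).ShortExact → ∃ s : M ⟶ E, s ≫ g = 𝟙 M) :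
    LiftsAlongExtensionsBy M M := by
  rintro S hS rfl h
  obtain ⟨s, hs⟩ := hM _ _ _ _ (shortExact_pullback hS h)
  exact ⟨s ≫ pullback.fst S.g h, by
    rw [Category.assoc, pullback.condition, reassoc_of% hs]⟩

theorem LiftsAlongExtensionsBy.exists_extension {M : 𝒜} {S : ShortComplex 𝒜}
    (hM : LiftsAlongExtensionsBy M S.X₃) (hS : S.ShortExact) (φ : S.X₁ ⟶ M) :
    ∃ ψ : S.X₂ ⟶ M, S.f ≫ ψ = φ := by
  have hE := shortExact_pushout hS φ
  have := hE.mono_f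
  obtain ⟨s, hs⟩ := hM _ hE rfl (𝟙 _)
  dsimp at s hs
  have hk : (pushout.inl S.f φ - S.g ≫ s) ≫ pushout.desc S.g 0 (by simp) = 0 := by
    rw [Preadditive.sub_comp, Category.assoc, hs, pushout.inl_desc, Category.comp_id, sub_self]
  refine ⟨hE.exact.lift _ hk, ?_⟩
  have hl : hE.exact.lift _ hk ≫ pushout.inr S.f φ = pushout.inl S.f φ - S.g ≫ s :=
    hE.exact.lift_f _ hk
  have : Mono (pushout.inr S.f φ) := hE.mono_f
  rw [← cancel_mono (pushout.inr S.f φ), Category.assoc]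
  refine (congrArg (S.f ≫ ·) hl).trans ?_
  rw [Preadditive.comp_sub, S.zero_assoc, zero_comp, sub_zero, pushout.condition]

theorem pdLE_one_hom_kernel {X Y M : 𝒜} (f : X ⟶ Y) [Epi f]
    [Module.Projective (End M) (X ⟶ M)] [Module.Projective (End M) (Y ⟶ M)]
    (hY : LiftsAlongExtensionsBy M Y) :
    pdLE (End M) 1 (ModuleCat.of (End M) (kernel f ⟶ M)) := by
  have hS : (ShortComplex.mk (kernel.ι f) f (kernel.condition f)).ShortExact :=
    ShortComplex.ShortExact.mk'
      (ShortComplex.exact_of_f_is_kernel _ (kernelIsKernel f)) inferInstance inferInstance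
  refine ⟨ModuleCat.of (End M) (X ⟶ M), precompLinear (kernel.ι f) M, ‹_›,
    fun φ => hY.exists_extension hS φ, ?_⟩
  change Module.Projective (End M) (LinearMap.ker (precompLinear (kernel.ι f) M))
  refine Module.Projective.of_equiv (M := (Y ⟶ M)) (LinearEquiv.ofBijective
    ((precompLinear f M).codRestrict _ fun φ => ?_) ⟨fun a b hab => ?_, fun ψ => ?_⟩)
  · exact (kernel.condition_assoc f φ).trans zero_comp
  · exact (cancel_epi f).1 (congrArg Subtype.val hab)
  · have hψ : kernel.ι f ≫ ψ.1 = 0 := ψ.2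
    exact ⟨hS.exact.desc ψ.1 hψ, Subtype.ext (hS.exact.g_desc ψ.1 hψ)⟩

end

theorem standard_modules_have_pd_le_one
    (k : Type v) [Field k] (𝒜 : Type u) [Category.{v} 𝒜] [Abelian 𝒜]
    [Preadditive 𝒜] [CategoryTheory.Linear k 𝒜]
    (C : Set 𝒜)
    -- C is Hom-finite :
    (hfin : ∀ X Y : 𝒜, X ∈ C → Y ∈ C → FiniteDimensional k (X ⟶ Y))
    -- C is extension closed :
    (hext : ∀ S : ShortComplex 𝒜, S.ShortExact → S.X₁ ∈ C → S.X₃ ∈ C → S.X₂ ∈ C)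
    -- M = M₁ ⊕ … ⊕ Mₙ with the Mᵢ indecomposable and pairwise nonisomorphic :
    (n : ℕ) (Mi : Fin n → 𝒜) (M : 𝒜) (hM : M ∈ C) (isoM : M ≅ ⨁ Mi)
    (hind : ∀ i, Indecomposable (Mi i))
    (hpair : ∀ i j, i ≠ j → IsEmpty (Mi i ≅ Mi j))
    -- Ext¹_C(M, M) = 0 :
    (hrigid : ∀ (E : 𝒜), E ∈ C → ∀ (f : M ⟶ E) (g : E ⟶ M) (w : f ≫ g = 0),
      (ShortComplex.mk f g w).ShortExact → ∃ s : M ⟶ E, s ≫ g = 𝟙 M)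
    -- the minimal left add(⊕_{j<i} Mⱼ)-approximations fᵢ : Mᵢ → Mᵢ', assumed surjective :
    (Mi' : Fin n → 𝒜) (f : ∀ i, Mi i ⟶ Mi' i)
    (htarget : ∀ i, BelowAdd Mi i (Mi' i))
    (happrox : ∀ i (X : 𝒜), BelowAdd Mi i X → ∀ g : Mi i ⟶ X, ∃ h : Mi' i ⟶ X, f i ≫ h = g)
    (hmin : ∀ i (g : Mi' i ⟶ Mi' i), f i ≫ g = f i → IsIso g)
    (hsurj : ∀ i, Epi (f i)) :
    -- each Δᵢ = Hom_C(Ker fᵢ, M) has projective dimension ≤ 1 over Γ = End_C(M) :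
    ∀ i, pdLE (End M) 1 (ModuleCat.of (End M) (kernel (f i) ⟶ M)) := by
  obtain rfl : ‹Preadditive 𝒜› = Abelian.toPreadditive := Subsingleton.elim _ _
  have hself : LiftsAlongExtensionsBy M M := .self fun E a b w hS =>
    hrigid E (hext _ hS hM hM) a b w hS
  have hsr (j : Fin n) : (biproduct.ι Mi j ≫ isoM.inv) ≫ isoM.hom ≫ biproduct.π Mi j = 𝟙 _ := by
    simp
  have hproj (j : Fin n) : Module.Projective (End M) (Mi j ⟶ M) :=
    projective_hom_of_retract _ _ (hsr j)
  intro i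
  obtain ⟨m, s, r, h⟩ := htarget i
  have := projective_hom_biproduct (fun q : Fin m × {j : Fin n // j < i} => Mi q.2.1) M
  have := projective_hom_of_retract (M := M) s r h
  have := hsurj i
  exact pdLE_one_hom_kernel (f i) <|
    (LiftsAlongExtensionsBy.biproduct fun q => hself.of_retract _ _ (hsr q.2.1)).of_retract s r h
end

section
/- Let A be a finite-dimensional algebra with id_A A ≤ 1, M a cluster tilting object in Sub A, Γ = End_A(M), and Ω M the syzygy of M with Ω̃M = A ⊕ ΩM. Then for every X in Sub A and every i > 0, Ext^i_Γ(Hom_A(X, M), Hom_A(Ω̃M, M)) = 0. -/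
open CategoryTheory

/-!
STATEMENT 8. Let A be a finite-dimensional algebra with id_A A ≤ 1, M a cluster tilting
object in Sub A, Γ = End_A(M), and ΩM the syzygy of M (kernel of a projective cover
p : P → M), with Ω̃M = A ⊕ ΩM.  Then for every X in Sub A and every i > 0,
Ext^i_Γ(Hom_A(X, M), Hom_A(Ω̃M, M)) = 0.
-/

def Ext1Zero (A : Type) [Ring A] (Z X : Type) [AddCommGroup Z] [Module A Z]
    [AddCommGroup X] [Module A X] : Prop :=
  ∀ (E : Type) [AddCommGroup E] [Module A E] (f : X →ₗ[A] E) (g : E →ₗ[A] Z),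
    Function.Injective f → Function.Surjective g → LinearMap.range f = LinearMap.ker g →
    ∃ s : Z →ₗ[A] E, g ∘ₗ s = LinearMap.id

def InSub (A : Type) [Ring A] (X : Type) [AddCommGroup X] [Module A X] : Prop :=
  ∃ (n : ℕ) (f : X →ₗ[A] (Fin n → A)), Function.Injective f

def InAdd (A : Type) [Ring A] (M X : Type) [AddCommGroup M] [Module A M]
    [AddCommGroup X] [Module A X] : Prop :=
  ∃ (n : ℕ) (s : X →ₗ[A] (Fin n → M)) (r : (Fin n → M) →ₗ[A] X), r ∘ₗ s = LinearMap.id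

def IsClusterTilting (A : Type) [Ring A] (M : Type) [AddCommGroup M] [Module A M] : Prop :=
  InSub A M ∧
  ∀ (X : Type) [AddCommGroup X] [Module A X], InSub A X →
    ((Ext1Zero A M X ↔ InAdd A M X) ∧ (Ext1Zero A X M ↔ InAdd A M X))

def InjDimLE1 (A : Type) [Ring A] : Prop :=
  ∃ (I₀ : ModuleCat.{0} A) (ι : A →ₗ[A] I₀), Module.Injective A I₀ ∧
    Function.Injective ι ∧ Module.Injective A (I₀ ⧸ LinearMap.range ι)

/-- `Ext^i` over the ring `R` (via the derived category of `ModuleCat R`). -/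
abbrev ModExt (R : Type) [Ring R] (X Y : Type) [AddCommGroup X] [Module R X]
    [AddCommGroup Y] [Module R Y] (i : ℕ) : Type 1 :=
  @Abelian.Ext (ModuleCat.{0} R) _ _
    (@hasExt_of_hasDerivedCategory _ _ _ (HasDerivedCategory.standard _))
    (ModuleCat.of R X) (ModuleCat.of R Y) i

theorem subsingleton_ext_of_projective_resolution {C : Type*} [Category C] [Abelian C]
    [HasExt C] {S : ShortComplex C} (hS : S.ShortExact) [Projective S.X₁] [Projective S.X₂]
    (Y : C) (hY : ∀ φ : S.X₁ ⟶ Y, ∃ ψ : S.X₂ ⟶ Y, S.f ≫ ψ = φ) (i : ℕ) (hi : 0 < i) :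
    Subsingleton (Abelian.Ext S.X₃ Y i) := by
  refine ⟨fun a b => ?_⟩
  suffices h : ∀ x : Abelian.Ext S.X₃ Y i, x = 0 by rw [h a, h b]
  intro x
  obtain ⟨n, rfl⟩ : ∃ n, i = 1 + n := ⟨i - 1, by omega⟩
  have hx : (Abelian.Ext.mk₀ S.g).comp x (zero_add _) = 0 := by
    have := Abelian.Ext.subsingleton_of_projective S.X₂ Y n
    rw [add_comm] at this
    exact Subsingleton.elim _ _
  obtain ⟨x₁, rfl⟩ := Abelian.Ext.contravariant_sequence_exact₃ hS Y x hx rfl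
  obtain - | n := n
  · obtain ⟨φ, rfl⟩ := (Abelian.Ext.mk₀_bijective S.X₁ Y).2 x₁
    obtain ⟨ψ, rfl⟩ := hY φ
    rw [← Abelian.Ext.mk₀_comp_mk₀, ← Abelian.Ext.comp_assoc_of_second_deg_zero,
      hS.extClass_comp, Abelian.Ext.zero_comp]
  · have := Abelian.Ext.subsingleton_of_projective S.X₁ Y n
    rw [Subsingleton.elim x₁ 0, Abelian.Ext.comp_zero]

section

variable {A : Type} [Ring A]

theorem Ext1Zero.exists_lift {Z X E Y : Type} [AddCommGroup Z] [Module A Z] [AddCommGroup X]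
    [Module A X] [AddCommGroup E] [Module A E] [AddCommGroup Y] [Module A Y]
    (h : Ext1Zero A Z X) (f : X →ₗ[A] E) (g : E →ₗ[A] Y) (hf : Function.Injective f)
    (hg : Function.Surjective g) (hfg : LinearMap.range f = LinearMap.ker g) (q : Z →ₗ[A] Y) :
    ∃ u : Z →ₗ[A] E, g ∘ₗ u = q := by
  let B : Submodule A (E × Z) :=
    LinearMap.eqLocus (g ∘ₗ LinearMap.fst A E Z) (q ∘ₗ LinearMap.snd A E Z)
  have hB : ∀ b : B, g b.1.1 = q b.1.2 := fun b => b.2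
  have hgf : ∀ x, g (f x) = 0 := fun x => by
    have : f x ∈ LinearMap.ker g := hfg ▸ LinearMap.mem_range_self f x
    exact this
  let f' : X →ₗ[A] B := (LinearMap.inl A E Z ∘ₗ f).codRestrict B fun x => by
    change g (f x) = q 0
    rw [hgf, map_zero]
  obtain ⟨s, hs⟩ := h B f' (LinearMap.snd A E Z ∘ₗ B.subtype)
    (fun x y hxy => hf (congrArg (fun b : B => b.1.1) hxy))
    (fun z => by
      obtain ⟨e, he⟩ := hg (q z)
      exact ⟨⟨(e, z), he⟩, rfl⟩)
    (by
      ext ⟨⟨e, z⟩, hez⟩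
      constructor
      · rintro ⟨x, hx⟩
        exact (congrArg (fun b : B => b.1.2) hx).symm
      · intro hz
        have hz : z = 0 := hz
        subst hz
        have he : e ∈ LinearMap.ker g := by
          have : g e = q 0 := hez
          rw [LinearMap.mem_ker, this, map_zero]
        rw [← hfg] at he
        obtain ⟨x, rfl⟩ := he
        exact ⟨x, rfl⟩)
  refine ⟨LinearMap.fst A E Z ∘ₗ B.subtype ∘ₗ s, ?_⟩
  ext z
  have hz : (s z).1.2 = z := LinearMap.congr_fun hs z
  exact (hB (s z)).trans (congrArg q hz)

theorem Ext1Zero.exists_extend {Z X P : Type} [AddCommGroup Z] [Module A Z] [AddCommGroup X]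
    [Module A X] [AddCommGroup P] [Module A P] (h : Ext1Zero A Z X) (p : P →ₗ[A] Z)
    (hp : Function.Surjective p) (φ : LinearMap.ker p →ₗ[A] X) :
    ∃ ψ : P →ₗ[A] X, ψ ∘ₗ (LinearMap.ker p).subtype = φ := by
  let R : Submodule A (P × X) := LinearMap.range ((LinearMap.ker p).subtype.prod (-φ))
  let g : ((P × X) ⧸ R) →ₗ[A] Z := R.liftQ (p ∘ₗ LinearMap.fst A P X) (by
    rintro _ ⟨x, rfl⟩
    exact x.2)
  have hg : ∀ y, g (R.mkQ y) = p y.1 := fun y => rfl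
  let f : X →ₗ[A] ((P × X) ⧸ R) := R.mkQ ∘ₗ LinearMap.inr A P X
  have hR : ∀ x : LinearMap.ker p, R.mkQ (x.1, 0) = f (φ x) := fun x => by
    refine (Submodule.Quotient.eq R).2 ⟨x, ?_⟩
    simp [LinearMap.prod_apply]
  have hf : Function.Injective f := by
    rw [injective_iff_map_eq_zero]
    intro x hx
    obtain ⟨y, hy⟩ := (Submodule.Quotient.mk_eq_zero R).1 hx
    have h1 : y = 0 := Subtype.ext (congrArg Prod.fst hy)
    have h2 : -φ y = x := congrArg Prod.snd hy
    rw [← h2, h1, map_zero, neg_zero]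
  have hker : LinearMap.range f = LinearMap.ker g := by
    apply le_antisymm
    · rintro _ ⟨x, rfl⟩
      exact map_zero p
    · intro e he
      obtain ⟨⟨a, x⟩, rfl⟩ := R.mkQ_surjective e
      refine ⟨φ ⟨a, he⟩ + x, ?_⟩
      rw [map_add, ← hR]
      change R.mkQ (a, 0) + R.mkQ (0, x) = _
      rw [← map_add]
      simp
  obtain ⟨s, hs⟩ := h _ f g hf (fun z => by
    obtain ⟨a, rfl⟩ := hp z
    exact ⟨R.mkQ (a, 0), rfl⟩) hker
  let d : P →ₗ[A] ((P × X) ⧸ R) := R.mkQ ∘ₗ LinearMap.inl A P X - s ∘ₗ p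
  have hd : ∀ a, d a ∈ LinearMap.range f := fun a => by
    rw [hker, LinearMap.mem_ker]
    change g (R.mkQ (a, 0) - s (p a)) = 0
    rw [map_sub, hg, sub_eq_zero]
    exact (LinearMap.congr_fun hs (p a)).symm
  refine ⟨(LinearEquiv.ofInjective f hf).symm ∘ₗ d.codRestrict _ hd, ?_⟩
  ext x
  apply hf
  have h1 : ∀ y, f ((LinearEquiv.ofInjective f hf).symm y) = y.1 := fun y =>
    congrArg Subtype.val ((LinearEquiv.ofInjective f hf).apply_symm_apply y)
  refine (h1 _).trans ?_
  change R.mkQ (x.1, 0) - s (p x.1) = _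
  rw [show p x.1 = 0 from x.2, map_zero, sub_zero, hR]

theorem ext1Zero_of_projective (Z X : Type) [AddCommGroup Z] [Module A Z] [AddCommGroup X]
    [Module A X] [Module.Projective A Z] : Ext1Zero A Z X :=
  fun _ _ _ _ g _ hg _ => Module.projective_lifting_property g LinearMap.id hg

theorem inAdd_self (M : Type) [AddCommGroup M] [Module A M] : InAdd A M M :=
  ⟨1, LinearMap.pi fun _ => LinearMap.id, LinearMap.proj 0, rfl⟩

/-- If `A` has injective dimension at most one, a map into `A` from the kernel of a map `q`
into a free module extends to the source of `q`. -/
theorem InjDimLE1.exists_extend (hid : InjDimLE1 A) {Y : Type} [AddCommGroup Y] [Module A Y]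
    {n : ℕ} (q : Y →ₗ[A] (Fin n → A)) (t : LinearMap.ker q →ₗ[A] A) :
    ∃ h : Y →ₗ[A] A, h ∘ₗ (LinearMap.ker q).subtype = t := by
  obtain ⟨I₀, ι, hI₀, hι, hI₁⟩ := hid
  let π := (LinearMap.range ι).mkQ
  obtain ⟨g, hg⟩ := hI₀.out (LinearMap.ker q).subtype Subtype.val_injective (ι ∘ₗ t)
  have hπ : ∀ a, π (ι a) = 0 := fun a =>
    (Submodule.Quotient.mk_eq_zero _).2 (LinearMap.mem_range_self ι a)
  let c : (Y ⧸ LinearMap.ker q) →ₗ[A] (I₀ ⧸ LinearMap.range ι) :=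
    (LinearMap.ker q).liftQ (π ∘ₗ g) fun y hy => by
      have := hg ⟨y, hy⟩
      change π (g y) = 0
      rw [show g y = ι (t ⟨y, hy⟩) from this, hπ]
  let j : (Y ⧸ LinearMap.ker q) →ₗ[A] (Fin n → A) := (LinearMap.ker q).liftQ q le_rfl
  have hj : Function.Injective j := by
    rw [← LinearMap.ker_eq_bot]
    exact Submodule.ker_liftQ_eq_bot _ _ _ le_rfl
  obtain ⟨e, he⟩ := hI₁.out j hj c
  obtain ⟨e', he'⟩ := Module.projective_lifting_property π e (Submodule.mkQ_surjective _)
  let d : Y →ₗ[A] I₀ := g - e' ∘ₗ q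
  have hd : ∀ y, d y ∈ LinearMap.range ι := fun y => by
    rw [← Submodule.Quotient.mk_eq_zero]
    change π (g y - e' (q y)) = 0
    rw [map_sub, sub_eq_zero]
    exact ((LinearMap.congr_fun he' (q y)).trans (he ((LinearMap.ker q).mkQ y))).symm
  refine ⟨(LinearEquiv.ofInjective ι hι).symm ∘ₗ d.codRestrict _ hd, ?_⟩
  ext x
  apply hι
  have h1 : ∀ y, ι ((LinearEquiv.ofInjective ι hι).symm y) = y.1 := fun y =>
    congrArg Subtype.val ((LinearEquiv.ofInjective ι hι).apply_symm_apply y)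
  refine (h1 _).trans ?_
  change g x.1 - e' (q x.1) = _
  rw [show q x.1 = 0 from x.2, map_zero, sub_zero]
  exact hg x

/-- Finitely many maps into `A` cut out the common kernel of any family of maps into `A`. -/
theorem exists_ker_pi_eq [IsArtinianRing A] {Y : Type} [AddCommGroup Y] [Module A Y]
    [Module.Finite A Y] (H : Set (Y →ₗ[A] A)) :
    ∃ (n : ℕ) (q : Y →ₗ[A] (Fin n → A)),
      (∀ i, LinearMap.proj i ∘ₗ q ∈ H) ∧ ∀ h ∈ H, LinearMap.ker q ≤ LinearMap.ker h := by
  obtain ⟨_, ⟨⟨n, q, hq⟩, rfl⟩, hmin⟩ := WellFounded.has_min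
    (wellFounded_lt (α := Submodule A Y))
    (Set.range fun x : Σ n, {q : Y →ₗ[A] (Fin n → A) // ∀ i, LinearMap.proj i ∘ₗ q ∈ H} =>
      LinearMap.ker x.2.1) ⟨_, ⟨0, 0, fun i => i.elim0⟩, rfl⟩
  refine ⟨n, q, hq, fun h hh y hy => ?_⟩
  by_contra hne
  let q' : Y →ₗ[A] (Fin (n + 1) → A) :=
    LinearMap.pi (Fin.cons h fun i => LinearMap.proj i ∘ₗ q)
  refine hmin _ ⟨⟨n + 1, q', fun i => ?_⟩, rfl⟩ (lt_of_le_of_ne (fun z hz => ?_) fun heq => ?_)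
  · rw [LinearMap.proj_pi]
    cases i using Fin.cases
    · exact hh
    · exact hq _
  · ext i
    exact congrFun hz i.succ
  · have hy' : y ∈ LinearMap.ker q' := (show LinearMap.ker q' = LinearMap.ker q from heq) ▸ hy
    exact hne (congrFun hy' 0)

theorem sum_comp_single_smul_proj_comp {M C : Type} [AddCommGroup M] [Module A M]
    [AddCommGroup C] [Module A C] {n : ℕ} {s : C →ₗ[A] (Fin n → M)} {r : (Fin n → M) →ₗ[A] C}
    (hrs : r ∘ₗ s = LinearMap.id) (h : C →ₗ[A] M) :
    ∑ i, (show Module.End A M from h ∘ₗ r ∘ₗ LinearMap.single A (fun _ => M) i) •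
      (LinearMap.proj i ∘ₗ s) = h := by
  ext c
  have hc : ∑ i, r (Pi.single i (s c i)) = c := by
    rw [← map_sum, Finset.univ_sum_single]
    exact LinearMap.congr_fun hrs c
  conv_rhs => rw [← hc]
  rw [LinearMap.sum_apply, map_sum]
  rfl

/-- A `Γ`-linear map `Hom(C, M) → Hom(W, M)` with `C ∈ add M` is precomposition with a map
`W → C`, where `Γ = End M`. -/
theorem InAdd.exists_eq_comp {M C W : Type} [AddCommGroup M] [Module A M] [AddCommGroup C]
    [Module A C] [AddCommGroup W] [Module A W] (hC : InAdd A M C)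
    (θ : (C →ₗ[A] M) →ₗ[Module.End A M] (W →ₗ[A] M)) :
    ∃ w : W →ₗ[A] C, ∀ h, θ h = h ∘ₗ w := by
  obtain ⟨n, s, r, hrs⟩ := hC
  refine ⟨r ∘ₗ LinearMap.pi fun i => θ (LinearMap.proj i ∘ₗ s), fun h => ?_⟩
  conv_lhs => rw [← sum_comp_single_smul_proj_comp hrs h]
  rw [map_sum]
  ext x
  rw [LinearMap.sum_apply]
  simp only [map_smul]
  rw [LinearMap.comp_apply, LinearMap.comp_apply, ← Finset.univ_sum_single (LinearMap.pi _ x),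
    map_sum, map_sum]
  rfl

/-- Precomposition as a `Γ`-linear map, where `Γ = End M`. -/
def precompEnd (M : Type) {X Y : Type} [AddCommGroup M] [Module A M] [AddCommGroup X]
    [Module A X] [AddCommGroup Y] [Module A Y] (f : X →ₗ[A] Y) :
    (Y →ₗ[A] M) →ₗ[Module.End A M] (X →ₗ[A] M) where
  toFun h := h ∘ₗ f
  map_add' _ _ := rfl
  map_smul' _ _ := rfl

theorem InAdd.projective_hom {M C : Type} [AddCommGroup M] [Module A M] [AddCommGroup C]
    [Module A C] (hC : InAdd A M C) : Module.Projective (Module.End A M) (C →ₗ[A] M) := by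
  obtain ⟨n, s, r, hrs⟩ := hC
  let e : (Fin n → Module.End A M) →ₗ[Module.End A M] (C →ₗ[A] M) :=
    { toFun := fun γ => ∑ i, γ i ∘ₗ LinearMap.proj i ∘ₗ s
      map_add' := fun γ δ => by simp [LinearMap.add_comp, Finset.sum_add_distrib]
      map_smul' := fun γ δ => by
        rw [RingHom.id_apply, Finset.smul_sum]
        rfl }
  let i : (C →ₗ[A] M) →ₗ[Module.End A M] (Fin n → Module.End A M) :=
    LinearMap.pi fun i => precompEnd M (r ∘ₗ LinearMap.single A (fun _ => M) i)
  exact Module.Projective.of_split i e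
    (LinearMap.ext fun h => sum_comp_single_smul_proj_comp hrs h)

theorem InSub.finite [IsNoetherianRing A] {X : Type} [AddCommGroup X] [Module A X]
    (hX : InSub A X) : Module.Finite A X :=
  let ⟨_, f, hf⟩ := hX
  Module.Finite.of_injective f hf

end

theorem finite_hom_end (k : Type) [Field k] (A : Type) [Ring A] [Algebra k A]
    [FiniteDimensional k A] (X M : Type) [AddCommGroup X] [Module A X] [Module.Finite A X]
    [AddCommGroup M] [Module A M] [Module.Finite A M] :
    Module.Finite (Module.End A M) (X →ₗ[A] M) := by
  let : Module k X := Module.compHom X (algebraMap k A)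
  let : Module k M := Module.compHom M (algebraMap k A)
  have : IsScalarTower k A X := IsScalarTower.of_algebraMap_smul fun _ _ => rfl
  have : IsScalarTower k A M := IsScalarTower.of_algebraMap_smul fun _ _ => rfl
  have : Module.Finite k X := Module.Finite.trans A X
  have : Module.Finite k M := Module.Finite.trans A M
  have : Module.Finite k (X →ₗ[A] M) :=
    Module.Finite.of_injective (LinearMap.restrictScalarsₗ k A X M k)
      (LinearMap.restrictScalars_injective k)
  have : IsScalarTower k (Module.End A M) (X →ₗ[A] M) := ⟨fun _ _ _ => rfl⟩
  exact Module.Finite.of_restrictScalars_finite k (Module.End A M) (X →ₗ[A] M)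

theorem exists_comp_eq_of_ker_le {A Y Z W : Type} [Ring A] [AddCommGroup Y] [Module A Y]
    [AddCommGroup Z] [Module A Z] [AddCommGroup W] [Module A W] (q : Y →ₗ[A] Z)
    (hq : Function.Surjective q) (h : Y →ₗ[A] W) (hle : LinearMap.ker q ≤ LinearMap.ker h) :
    ∃ h' : Z →ₗ[A] W, h' ∘ₗ q = h := by
  refine ⟨(LinearMap.ker q).liftQ h hle ∘ₗ (q.quotKerEquivOfSurjective hq).symm, ?_⟩
  ext y
  have : (q.quotKerEquivOfSurjective hq).symm (q y) = (LinearMap.ker q).mkQ y :=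
    (LinearEquiv.symm_apply_eq _).2 rfl
  change (LinearMap.ker q).liftQ h hle ((q.quotKerEquivOfSurjective hq).symm (q y)) = h y
  rw [this]
  rfl

/-- If `f : X → Mʳ` is a left `add M`-approximation and `q` is a map from `Mʳ` to a free module
whose kernel is the reject of `A` relative to `f`, then `Ext¹(im q, M) = 0`. -/
theorem ext1Zero_range {A M X : Type} [Ring A] [AddCommGroup M] [Module A M] [AddCommGroup X]
    [Module A X] (hid : InjDimLE1 A) (hMM : Ext1Zero A M M) (hMA : InSub A M) {r n : ℕ}
    (f : X →ₗ[A] (Fin r → M)) (hf : ∀ g : X →ₗ[A] M, ∃ h : (Fin r → M) →ₗ[A] M, h ∘ₗ f = g)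
    (q : (Fin r → M) →ₗ[A] (Fin n → A)) (hqf : ∀ x, q (f x) = 0)
    (hq : ∀ h : (Fin r → M) →ₗ[A] A, h ∘ₗ f = 0 → LinearMap.ker q ≤ LinearMap.ker h) :
    Ext1Zero A (LinearMap.range q) M := by
  have hext : ∀ t : LinearMap.ker q →ₗ[A] M,
      ∃ h : (Fin r → M) →ₗ[A] M, h ∘ₗ (LinearMap.ker q).subtype = t := by
    intro t
    let f' : X →ₗ[A] LinearMap.ker q := f.codRestrict _ hqf
    obtain ⟨h, hh⟩ := hf (t ∘ₗ f')
    refine ⟨h, ?_⟩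
    obtain ⟨m, j, hj⟩ := hMA
    ext y
    apply hj
    ext i
    obtain ⟨h₂, hh₂⟩ := hid.exists_extend q
      (LinearMap.proj i ∘ₗ j ∘ₗ (h ∘ₗ (LinearMap.ker q).subtype - t))
    have h₂f : h₂ ∘ₗ f = 0 := by
      ext x
      have h1 : h₂ (f x) = j (h (f x) - t (f' x)) i := LinearMap.congr_fun hh₂ (f' x)
      have h2 : h (f x) = t (f' x) := LinearMap.congr_fun hh x
      rw [LinearMap.comp_apply, h1, h2, sub_self, map_zero]
      rfl
    have h3 : h₂ y.1 = 0 := hq h₂ h₂f y.2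
    have h4 : h₂ y.1 = j (h y.1 - t y) i := LinearMap.congr_fun hh₂ y
    rw [h3, map_sub, Pi.sub_apply] at h4
    exact sub_eq_zero.1 h4.symm
  intro E _ _ a b ha hb hab
  choose u hu using fun i => hMM.exists_lift a b ha hb hab
    (q.rangeRestrict ∘ₗ LinearMap.single A (fun _ => M) i)
  let v : (Fin r → M) →ₗ[A] E := LinearMap.lsum A (fun _ => M) ℕ u
  have hv : b ∘ₗ v = q.rangeRestrict := by
    refine LinearMap.pi_ext' fun i => ?_
    rw [← hu i]
    ext1 x
    exact congrArg b (LinearMap.lsum_piSingle A (fun _ => M) ℕ u i x)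
  have hmem : ∀ y : LinearMap.ker q, v y.1 ∈ LinearMap.range a := fun y => by
    rw [hab, LinearMap.mem_ker]
    refine (LinearMap.congr_fun hv y.1).trans (Subtype.ext ?_)
    exact y.2
  obtain ⟨h, hh⟩ := hext ((LinearEquiv.ofInjective a ha).symm ∘ₗ
    (v ∘ₗ (LinearMap.ker q).subtype).codRestrict _ hmem)
  have hah : ∀ y ∈ LinearMap.ker q, a (h y) = v y := fun y hy => by
    have h1 : h y = (LinearEquiv.ofInjective a ha).symm ⟨v y, hmem ⟨y, hy⟩⟩ :=
      LinearMap.congr_fun hh ⟨y, hy⟩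
    rw [h1]
    exact congrArg Subtype.val ((LinearEquiv.ofInjective a ha).apply_symm_apply _)
  obtain ⟨s, hs⟩ := exists_comp_eq_of_ker_le q.rangeRestrict q.surjective_rangeRestrict
    (v - a ∘ₗ h) (fun y hy => by
      rw [LinearMap.ker_rangeRestrict] at hy
      simp [hah y hy])
  refine ⟨s, ?_⟩
  ext1 z
  obtain ⟨y, rfl⟩ := q.surjective_rangeRestrict z
  have hba : b (a (h y)) = 0 := by
    have : a (h y) ∈ LinearMap.ker b := hab ▸ LinearMap.mem_range_self a _
    exact this
  have h1 : s (q.rangeRestrict y) = v y - a (h y) := LinearMap.congr_fun hs y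
  rw [LinearMap.comp_apply, h1, map_sub, hba, sub_zero]
  exact LinearMap.congr_fun hv y

theorem exists_left_approximation (k : Type) [Field k] (A : Type) [Ring A] [Algebra k A]
    [FiniteDimensional k A] (X M : Type) [AddCommGroup X] [Module A X] [Module.Finite A X]
    [AddCommGroup M] [Module A M] [Module.Finite A M] :
    ∃ (r : ℕ) (f : X →ₗ[A] (Fin r → M)),
      ∀ g : X →ₗ[A] M, ∃ h : (Fin r → M) →ₗ[A] M, h ∘ₗ f = g := by
  have := finite_hom_end k A X M
  obtain ⟨r, c, hc⟩ := Module.Finite.exists_fin' (Module.End A M) (X →ₗ[A] M)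
  refine ⟨r, LinearMap.pi fun i => c (Pi.single i 1), fun g => ?_⟩
  obtain ⟨γ, rfl⟩ := hc g
  refine ⟨∑ i, γ i ∘ₗ LinearMap.proj i, ?_⟩
  have hγ : γ = ∑ i, γ i • Pi.single i (1 : Module.End A M) := by
    simpa [← Pi.single_smul] using (Finset.univ_sum_single γ).symm
  conv_rhs => rw [hγ]
  rw [map_sum]
  ext x
  simp

theorem ext_vanishing_into_characteristic_tilting
    (k : Type) [Field k] (A : Type) [Ring A] [Algebra k A] [FiniteDimensional k A]
    (hid : InjDimLE1 A)
    (M : Type) [AddCommGroup M] [Module A M] (hM : IsClusterTilting A M)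
    -- a projective cover p : P → M, with syzygy ΩM = ker p :
    (P : Type) [AddCommGroup P] [Module A P] (hP : Module.Projective A P)
    (p : P →ₗ[A] M) (hp : Function.Surjective p)
    (hsmall : ∀ N : Submodule A P, N ⊔ LinearMap.ker p = ⊤ → N = ⊤)
    -- X in Sub A :
    (X : Type) [AddCommGroup X] [Module A X] (hX : InSub A X) :
    -- Ext^i_Γ(Hom_A(X,M), Hom_A(A ⊕ ΩM, M)) = 0 for all i > 0 :
    ∀ i : ℕ, 0 < i →
      Subsingleton (ModExt (Module.End A M)
        (X →ₗ[A] M) ((A × LinearMap.ker p) →ₗ[A] M) i) := by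
  have : IsArtinianRing A := IsArtinianRing.of_finite k A
  have := hX.finite
  have := hM.1.finite
  obtain ⟨r, f, hf⟩ := exists_left_approximation k A X M
  obtain ⟨n, q, hqf, hq⟩ := exists_ker_pi_eq {h : (Fin r → M) →ₗ[A] A | h ∘ₗ f = 0}
  have hqf' : ∀ x, q (f x) = 0 := fun x => funext fun i => LinearMap.congr_fun (hqf i) x
  have hMM : Ext1Zero A M M := ((hM.2 M hM.1).1).2 (inAdd_self M)
  have hCA : InSub A (LinearMap.range q) := ⟨n, Submodule.subtype _, Subtype.val_injective⟩
  have hC : InAdd A M (LinearMap.range q) :=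
    (hM.2 _ hCA).2.1 (ext1Zero_range hid hMM hM.1 f hf q hqf' hq)
  have hMC : Ext1Zero A M (LinearMap.range q) := (hM.2 _ hCA).1.2 hC
  have hker : ∀ h : (Fin r → M) →ₗ[A] M, h ∘ₗ f = 0 →
      LinearMap.ker q.rangeRestrict ≤ LinearMap.ker h := by
    intro h hh y hy
    rw [LinearMap.ker_rangeRestrict] at hy
    obtain ⟨m, j, hj⟩ := hM.1
    apply hj
    rw [map_zero]
    ext i
    refine hq (LinearMap.proj i ∘ₗ j ∘ₗ h) ?_ hy
    change LinearMap.proj i ∘ₗ j ∘ₗ h ∘ₗ f = 0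
    rw [hh, LinearMap.comp_zero, LinearMap.comp_zero]
  let α := precompEnd M q.rangeRestrict
  let β := precompEnd M f
  have hexact : LinearMap.range α = LinearMap.ker β := by
    apply le_antisymm
    · rintro _ ⟨h, rfl⟩
      ext x
      have : q.rangeRestrict (f x) = 0 := Subtype.ext (hqf' x)
      change h (q.rangeRestrict (f x)) = 0
      rw [this, map_zero]
    · intro h hh
      exact exists_comp_eq_of_ker_le _ q.surjective_rangeRestrict h (hker h hh)
  let S : ShortComplex (ModuleCat.{0} (Module.End A M)) :=
    ShortComplex.moduleCatMkOfKerLERange (ModuleCat.ofHom α) (ModuleCat.ofHom β) hexact.le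
  have hS : S.ShortExact :=
    { exact := ShortComplex.Exact.moduleCat_of_range_eq_ker _ _ hexact
      mono_f := (ModuleCat.mono_iff_injective _).2 fun h₁ h₂ hh => by
        refine LinearMap.ext fun z => ?_
        obtain ⟨y, rfl⟩ := q.surjective_rangeRestrict z
        exact LinearMap.congr_fun hh y
      epi_g := (ModuleCat.epi_iff_surjective _).2 hf }
  have hP₁ := hC.projective_hom
  have hP₂ := InAdd.projective_hom (A := A) (M := M) (C := Fin r → M)
    ⟨r, LinearMap.id, LinearMap.id, rfl⟩
  have : Projective S.X₁ := (IsProjective.iff_projective _).1 hP₁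
  have : Projective S.X₂ := (IsProjective.iff_projective _).1 hP₂
  refine @subsingleton_ext_of_projective_resolution _ _ _
    (@hasExt_of_hasDerivedCategory _ _ _ (HasDerivedCategory.standard _)) S hS _ _ _ fun φ => ?_
  obtain ⟨w, hw⟩ := hC.exists_eq_comp φ.hom
  obtain ⟨w₂, hw₂⟩ := hMC.exists_extend p hp (w ∘ₗ LinearMap.inr A A (LinearMap.ker p))
  obtain ⟨l₁, hl₁⟩ := Module.projective_lifting_property q.rangeRestrict
    (w ∘ₗ LinearMap.inl A A (LinearMap.ker p)) q.surjective_rangeRestrict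
  obtain ⟨l₂, hl₂⟩ := Module.projective_lifting_property q.rangeRestrict w₂
    q.surjective_rangeRestrict
  let l := l₁.coprod (l₂ ∘ₗ (LinearMap.ker p).subtype)
  have hl : q.rangeRestrict ∘ₗ l = w := by
    refine LinearMap.prod_ext ?_ ?_
    · rw [LinearMap.comp_assoc, LinearMap.coprod_inl, hl₁]
    · rw [LinearMap.comp_assoc, LinearMap.coprod_inr, ← LinearMap.comp_assoc, hl₂, hw₂]
  refine ⟨ModuleCat.ofHom (precompEnd M l), ModuleCat.hom_ext (LinearMap.ext fun h => ?_)⟩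
  refine Eq.trans ?_ (hw h).symm
  change h ∘ₗ q.rangeRestrict ∘ₗ l = h ∘ₗ w
  rw [hl]
end
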